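/- Let R = [r] × [s] and let x, z ∈ ℝ_{>0}^R. Suppose that for every 1 ≤ i ≤ r, the generalized Stanley–Thomas word ST_i(z) is the cyclic shift of ST_i(x) (i.e., ST_i(z)_k = ST_i(x)_{k−1} for all k, indices taken modulo r+s), and similarly ST̄_j(z) is the cyclic shift of ST̄_j(x) for every 1 ≤ j ≤ s. Then z = φ(ρ(φ⁻¹(x))). Consequently, φ ∘ ρ ∘ φ⁻¹ is the unique function on ℝ_{>0}^R that cyclically shifts all generalized Stanley–Thomas words. -/

import Mathlib

namespace Paper

/-- Membership in the rectangle poset `R = [1,r] × [1,s]` (coordinates in `ℤ`). -/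
def inR (r s : ℕ) (p : ℤ × ℤ) : Prop :=
  1 ≤ p.1 ∧ p.1 ≤ (r : ℤ) ∧ 1 ≤ p.2 ∧ p.2 ≤ (s : ℤ)

instance (r s : ℕ) : DecidablePred (inR r s) := fun _ => by unfold inR; infer_instance

/-- The cover relation in the product of two chains. -/
def CoverStep (p q : ℤ × ℤ) : Prop :=
  (q.1 = p.1 + 1 ∧ q.2 = p.2) ∨ (q.1 = p.1 ∧ q.2 = p.2 + 1)

/-- Upper covers of `p` inside the rectangle. -/
def upSet (r s : ℕ) (p : ℤ × ℤ) : Finset (ℤ × ℤ) :=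
  ({(p.1 + 1, p.2), (p.1, p.2 + 1)} : Finset (ℤ × ℤ)).filter (inR r s)

/-- Lower covers of `p` inside the rectangle. -/
def downSet (r s : ℕ) (p : ℤ × ℤ) : Finset (ℤ × ℤ) :=
  ({(p.1 - 1, p.2), (p.1, p.2 - 1)} : Finset (ℤ × ℤ)).filter (inR r s)

/-- Sum of the labels of the lower covers of `p` (empty sum = 1). -/
noncomputable def dsum (r s : ℕ) (x : ℤ × ℤ → ℝ) (p : ℤ × ℤ) : ℝ :=
  if (downSet r s p).Nonempty then ∑ q ∈ downSet r s p, x q else 1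

/-- Parallel sum of the labels of the upper covers of `p` (empty parallel sum = 1). -/
noncomputable def usum (r s : ℕ) (x : ℤ × ℤ → ℝ) (p : ℤ × ℤ) : ℝ :=
  if (upSet r s p).Nonempty then (∑ q ∈ upSet r s p, (x q)⁻¹)⁻¹ else 1

/-- The birational toggle at `p`. -/
noncomputable def toggle (r s : ℕ) (p : ℤ × ℤ) (x : ℤ × ℤ → ℝ) : ℤ × ℤ → ℝ :=
  fun q => if q = p then usum r s x p * dsum r s x p / x p else x q

/-- The elements of `[1,a] × [1,b]` listed from top to bottom
(descending lexicographic order, the reverse of a linear extension). -/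
def rectList (a b : ℕ) : List (ℤ × ℤ) :=
  (List.range a).reverse.flatMap fun i =>
    (List.range b).reverse.map fun j => ((i : ℤ) + 1, (j : ℤ) + 1)

/-- Birational rowmotion on the rectangle: toggles from top to bottom. -/
noncomputable def rho (r s : ℕ) (x : ℤ × ℤ → ℝ) : ℤ × ℤ → ℝ :=
  (rectList r s).foldl (fun y p => toggle r s p y) x

/-- Inverse birational rowmotion: toggles from bottom to top. -/
noncomputable def rhoInv (r s : ℕ) (x : ℤ × ℤ → ℝ) : ℤ × ℤ → ℝ :=
  (rectList r s).reverse.foldl (fun y p => toggle r s p y) x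

/-- Integer powers of birational rowmotion. -/
noncomputable def rhoPow (r s : ℕ) (k : ℤ) (x : ℤ × ℤ → ℝ) : ℤ × ℤ → ℝ :=
  if 0 ≤ k then (rho r s)^[k.toNat] x else (rhoInv r s)^[(-k).toNat] x

/-- Saturated chains from `a` to `b`, as lists of successive cover steps. -/
def ChainList (a b : ℤ × ℤ) : Type :=
  {l : List (ℤ × ℤ) // l.Chain' CoverStep ∧ l.head? = some a ∧ l.getLast? = some b}

/-- The inverse birational transfer map on the rectangle: `φ⁻¹(x)_p` is the total weight
of all saturated chains from the minimal element `(1,1)` to `p`. -/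
noncomputable def phiInv (x : ℤ × ℤ → ℝ) : ℤ × ℤ → ℝ :=
  fun p => ∑ᶠ c : ChainList (1, 1) p, (c.1.map x).prod

/-- The birational transfer map `φ(x)_p = x_p / ∑_{q ⋖ p} x_q`. -/
noncomputable def phi (r s : ℕ) (x : ℤ × ℤ → ℝ) : ℤ × ℤ → ℝ :=
  fun p => x p / dsum r s x p

/-- A collection of `k` pairwise vertex-disjoint lattice paths in the interval
`[i₁,i₂] × [j₁,j₂]`, from `(i₁,j₁),…,(i₁,j₁+k-1)` to `(i₂,j₂-k+1),…,(i₂,j₂)`. -/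
structure RSys (i₁ i₂ j₁ j₂ : ℤ) (k : ℕ) where
  path : Fin k → List (ℤ × ℤ)
  chain : ∀ t, (path t).Chain' CoverStep
  mem : ∀ t, ∀ v ∈ path t, i₁ ≤ v.1 ∧ v.1 ≤ i₂ ∧ j₁ ≤ v.2 ∧ v.2 ≤ j₂
  first : ∀ t : Fin k, (path t).head? = some (i₁, j₁ + ((t : ℕ) : ℤ))
  final : ∀ t : Fin k, (path t).getLast? = some (i₂, j₂ - k + 1 + ((t : ℕ) : ℤ))
  disjoint : ∀ t t' : Fin k, t ≠ t' → ∀ v ∈ path t, v ∉ path t'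

/-- The weight of a collection of paths: the product of labels of all its elements. -/
noncomputable def RSysWeight (x : ℤ × ℤ → ℝ) {i₁ i₂ j₁ j₂ : ℤ} {k : ℕ}
    (L : RSys i₁ i₂ j₁ j₂ k) : ℝ :=
  ∏ t : Fin k, ((L.path t).map x).prod

/-- `w_I^{(k)}(x)`: total weight of all collections of `k` nonintersecting paths in the
interval `I = [i₁,i₂] × [j₁,j₂]` (with `w_I^{(0)} = 1`). -/
noncomputable def w (i₁ i₂ j₁ j₂ : ℤ) (k : ℤ) (x : ℤ × ℤ → ℝ) : ℝ :=
  if k ≤ 0 then 1 else ∑ᶠ L : RSys i₁ i₂ j₁ j₂ k.toNat, RSysWeight x L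

/-- `w_I(x)`: the product of all labels in the interval `I = [i₁,i₂] × [j₁,j₂]`. -/
noncomputable def wProd (i₁ i₂ j₁ j₂ : ℤ) (x : ℤ × ℤ → ℝ) : ℝ :=
  ∏ p ∈ Finset.Icc i₁ i₂ ×ˢ Finset.Icc j₁ j₂, x p

/-- The directed edges of the graph `𝒢_R` on vertex set `[1,r+1] × [1,s]`:
`(i,j) → (i+1,j)` for `(i,j) ∈ R`, and `(i,j) → (i+1,j-1)` when valid. -/
def GEdge (r s : ℕ) (p q : ℤ × ℤ) : Prop :=
  1 ≤ p.1 ∧ p.1 ≤ (r : ℤ) ∧ 1 ≤ p.2 ∧ p.2 ≤ (s : ℤ) ∧ q.1 = p.1 + 1 ∧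
    (q.2 = p.2 ∨ (q.2 = p.2 - 1 ∧ 2 ≤ p.2))

/-- The weight of an edge of `𝒢_R`: `x_p⁻¹` for vertical edges, `1` for diagonal ones. -/
noncomputable def edgeWt (x : ℤ × ℤ → ℝ) (p q : ℤ × ℤ) : ℝ :=
  if q.2 = p.2 then (x p)⁻¹ else 1

/-- The weight of a directed path in `𝒢_R`, given as its list of vertices. -/
noncomputable def listWt (x : ℤ × ℤ → ℝ) (l : List (ℤ × ℤ)) : ℝ :=
  ((l.zip l.tail).map fun e => edgeWt x e.1 e.2).prod

/-- The boundary vertex `P_t` of `𝒢_R`: `P_j = (1,j)` for `1 ≤ j ≤ s`, `P_{s+i} = (i+1,s)`. -/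
def Pvert (s : ℕ) (t : ℤ) : ℤ × ℤ := if t ≤ (s : ℤ) then (1, t) else (t - s + 1, (s : ℤ))

/-- The boundary vertex `Q_t` of `𝒢_R`: `Q_i = (i,1)` for `1 ≤ i ≤ r`, `Q_{r+j} = (r+1,j)`. -/
def Qvert (r : ℕ) (t : ℤ) : ℤ × ℤ := if t ≤ (r : ℤ) then (t, 1) else ((r : ℤ) + 1, t - r)

/-- A collection of `k` pairwise vertex-disjoint directed paths in `𝒢_R` from
`{P_i, …, P_{i+k-1}}` to `{Q_j, …, Q_{j+k-1}}`. -/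
structure GSys (r s : ℕ) (i j : ℤ) (k : ℕ) where
  perm : Equiv.Perm (Fin k)
  path : Fin k → List (ℤ × ℤ)
  chain : ∀ t, (path t).Chain' (GEdge r s)
  first : ∀ t : Fin k, (path t).head? = some (Pvert s (i + ((t : ℕ) : ℤ)))
  final : ∀ t : Fin k, (path t).getLast? = some (Qvert r (j + (((perm t) : ℕ) : ℤ)))
  disjoint : ∀ t t' : Fin k, t ≠ t' → ∀ v ∈ path t, v ∉ path t'

/-- The weight of a collection of paths in `𝒢_R`: the product of the weights of all
edges used. -/
noncomputable def GSysWeight (x : ℤ × ℤ → ℝ) {r s : ℕ} {i j : ℤ} {k : ℕ}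
    (L : GSys r s i j k) : ℝ :=
  ∏ t : Fin k, listWt x (L.path t)

/-- `W_{ij}^{(k)}(x)`: total weight of all collections of `k` nonintersecting paths in
`𝒢_R` from `{P_i,…,P_{i+k-1}}` to `{Q_j,…,Q_{j+k-1}}`; `W_{ij}^{(0)} = 1`, and `0` when an
out-of-range index occurs. -/
noncomputable def W (r s : ℕ) (x : ℤ × ℤ → ℝ) (i j k : ℤ) : ℝ :=
  if k < 0 then 0
  else if k = 0 then 1
  else if 1 ≤ i ∧ 1 ≤ j ∧ i + k - 1 ≤ (r : ℤ) + s ∧ j + k - 1 ≤ (r : ℤ) + s then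
    ∑ᶠ L : GSys r s i j k.toNat, GSysWeight x L
  else 0


/-- The `k`-th entry of the generalized Stanley–Thomas word `ST_i(x)`:
`ρ^{-k}(φ⁻¹(x))_{is}`. -/
noncomputable def STentry (r s : ℕ) (x : ℤ × ℤ → ℝ) (i : ℤ) (k : ℕ) : ℝ :=
  (rhoInv r s)^[k] (phiInv x) (i, (s : ℤ))

/-- The `k`-th entry of the generalized Stanley–Thomas word `ST̄_j(x)`:
`ρ^{-k}(φ⁻¹(x))_{rj}`. -/
noncomputable def STbarEntry (r s : ℕ) (x : ℤ × ℤ → ℝ) (j : ℤ) (k : ℕ) : ℝ :=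
  (rhoInv r s)^[k] (phiInv x) ((r : ℤ), j)

/-! ### Toggles -/

lemma toggle_of_ne {r s : ℕ} {p q : ℤ × ℤ} (x : ℤ × ℤ → ℝ) (h : q ≠ p) :
    toggle r s p x q = x q := by
  simp [toggle, h]

lemma toggle_self (r s : ℕ) (p : ℤ × ℤ) (x : ℤ × ℤ → ℝ) :
    toggle r s p x p = usum r s x p * dsum r s x p / x p := by
  simp [toggle]

lemma mem_upSet {r s : ℕ} {p q : ℤ × ℤ} :
    q ∈ upSet r s p ↔ (q = (p.1 + 1, p.2) ∨ q = (p.1, p.2 + 1)) ∧ inR r s q := by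
  simp [upSet]

lemma mem_downSet {r s : ℕ} {p q : ℤ × ℤ} :
    q ∈ downSet r s p ↔ (q = (p.1 - 1, p.2) ∨ q = (p.1, p.2 - 1)) ∧ inR r s q := by
  simp [downSet]

lemma usum_congr {r s : ℕ} {p : ℤ × ℤ} {x y : ℤ × ℤ → ℝ}
    (h : ∀ q ∈ upSet r s p, x q = y q) : usum r s x p = usum r s y p := by
  unfold usum
  rw [Finset.sum_congr rfl fun q hq => by rw [h q hq]]

lemma dsum_congr {r s : ℕ} {p : ℤ × ℤ} {x y : ℤ × ℤ → ℝ}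
    (h : ∀ q ∈ downSet r s p, x q = y q) : dsum r s x p = dsum r s y p := by
  unfold dsum
  rw [Finset.sum_congr rfl h]

lemma usum_pos {r s : ℕ} {x : ℤ × ℤ → ℝ} (hx : ∀ q, inR r s q → 0 < x q) (p : ℤ × ℤ) :
    0 < usum r s x p := by
  unfold usum
  split_ifs with h
  · exact inv_pos.2 (Finset.sum_pos (fun q hq => inv_pos.2 (hx q (mem_upSet.1 hq).2)) h)
  · exact one_pos

lemma dsum_pos {r s : ℕ} {x : ℤ × ℤ → ℝ} (hx : ∀ q, inR r s q → 0 < x q) (p : ℤ × ℤ) :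
    0 < dsum r s x p := by
  unfold dsum
  split_ifs with h
  · exact Finset.sum_pos (fun q hq => hx q (mem_downSet.1 hq).2) h
  · exact one_pos

lemma toggle_pos {r s : ℕ} {x : ℤ × ℤ → ℝ} (hx : ∀ q, inR r s q → 0 < x q) (p : ℤ × ℤ) :
    ∀ q, inR r s q → 0 < toggle r s p x q := by
  intro q hq
  by_cases h : q = p
  · subst h
    rw [toggle_self]
    exact div_pos (mul_pos (usum_pos hx q) (dsum_pos hx q)) (hx q hq)
  · rw [toggle_of_ne x h]
    exact hx q hq

lemma toggle_congr {r s : ℕ} {x y : ℤ × ℤ → ℝ} (h : ∀ q, inR r s q → x q = y q) (p : ℤ × ℤ) :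
    ∀ q, inR r s q → toggle r s p x q = toggle r s p y q := by
  intro q hq
  by_cases hqp : q = p
  · subst hqp
    rw [toggle_self, toggle_self, usum_congr fun q hq => h q (mem_upSet.1 hq).2,
      dsum_congr fun q hq => h q (mem_downSet.1 hq).2, h q hq]
  · rw [toggle_of_ne x hqp, toggle_of_ne y hqp, h q hq]

lemma ne_of_mem_upSet {r s : ℕ} {p q : ℤ × ℤ} (h : q ∈ upSet r s p) : q ≠ p := by
  rintro rfl
  rcases (mem_upSet.1 h).1 with h | h <;> simp only [Prod.ext_iff] at h <;> omega

lemma ne_of_mem_downSet {r s : ℕ} {p q : ℤ × ℤ} (h : q ∈ downSet r s p) : q ≠ p := by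
  rintro rfl
  rcases (mem_downSet.1 h).1 with h | h <;> simp only [Prod.ext_iff] at h <;> omega

lemma toggle_toggle {r s : ℕ} {x : ℤ × ℤ → ℝ} (hx : ∀ q, inR r s q → 0 < x q) {p : ℤ × ℤ}
    (hp : inR r s p) : toggle r s p (toggle r s p x) = x := by
  funext q
  by_cases h : q = p
  · subst h
    have hu := (usum_pos hx q).ne'
    have hd := (dsum_pos hx q).ne'
    have hxq := (hx q hp).ne'
    rw [toggle_self, usum_congr fun t ht => toggle_of_ne x (ne_of_mem_upSet ht),
      dsum_congr fun t ht => toggle_of_ne x (ne_of_mem_downSet ht), toggle_self]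
    field_simp
  · rw [toggle_of_ne _ h, toggle_of_ne _ h]

/-! ### Compositions of toggles along a list -/

lemma foldl_toggle_pos {r s : ℕ} (l : List (ℤ × ℤ)) {x : ℤ × ℤ → ℝ}
    (hx : ∀ q, inR r s q → 0 < x q) :
    ∀ q, inR r s q → 0 < l.foldl (fun y p => toggle r s p y) x q := by
  induction l generalizing x with
  | nil => exact hx
  | cons p l ih => exact ih (toggle_pos hx p)

lemma foldl_toggle_congr {r s : ℕ} (l : List (ℤ × ℤ)) {x y : ℤ × ℤ → ℝ}
    (h : ∀ q, inR r s q → x q = y q) :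
    ∀ q, inR r s q → l.foldl (fun y p => toggle r s p y) x q =
      l.foldl (fun y p => toggle r s p y) y q := by
  induction l generalizing x y with
  | nil => exact h
  | cons p l ih => exact ih (toggle_congr h p)

lemma foldl_toggle_of_notMem {r s : ℕ} {l : List (ℤ × ℤ)} {q : ℤ × ℤ} (x : ℤ × ℤ → ℝ)
    (hq : q ∉ l) : l.foldl (fun y p => toggle r s p y) x q = x q := by
  induction l generalizing x with
  | nil => rfl
  | cons p l ih =>
    rw [List.mem_cons, not_or] at hq
    rw [List.foldl_cons, ih _ hq.2, toggle_of_ne x hq.1]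

lemma foldl_toggle_reverse {r s : ℕ} {l : List (ℤ × ℤ)} (hl : ∀ p ∈ l, inR r s p)
    {x : ℤ × ℤ → ℝ} (hx : ∀ q, inR r s q → 0 < x q) :
    l.reverse.foldl (fun y p => toggle r s p y) (l.foldl (fun y p => toggle r s p y) x) = x := by
  induction l generalizing x with
  | nil => rfl
  | cons p l ih =>
    rw [List.reverse_cons, List.foldl_append, List.foldl_cons, List.foldl_cons,
      ih (fun q hq => hl q (List.mem_cons_of_mem p hq)) (toggle_pos hx p)]
    exact toggle_toggle hx (hl p List.mem_cons_self)

/-- The strict lexicographic order on `ℤ × ℤ`. -/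
def LexLT (p q : ℤ × ℤ) : Prop := p.1 < q.1 ∨ (p.1 = q.1 ∧ p.2 < q.2)

lemma foldl_toggle_apply {r s : ℕ} {l : List (ℤ × ℤ)} (hl : l.Pairwise LexLT)
    (x : ℤ × ℤ → ℝ) {p : ℤ × ℤ} (hp : p ∈ l) :
    l.foldl (fun y p => toggle r s p y) x p =
      usum r s x p * dsum r s (l.foldl (fun y p => toggle r s p y) x) p / x p := by
  obtain ⟨l₁, l₂, rfl⟩ := List.append_of_mem hp
  rw [List.pairwise_append, List.pairwise_cons] at hl
  obtain ⟨-, ⟨h₂, -⟩, h₁⟩ := hl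
  have h₁ : ∀ a ∈ l₁, LexLT a p := fun a ha => h₁ a ha p List.mem_cons_self
  have hp₁ : p ∉ l₁ := fun h => by have := h₁ p h; simp [LexLT] at this
  have hp₂ : p ∉ l₂ := fun h => by have := h₂ p h; simp [LexLT] at this
  have hup : ∀ q ∈ upSet r s p, q ∉ l₁ := fun q hq h => by
    have := h₁ q h
    rcases (mem_upSet.1 hq).1 with rfl | rfl <;> simp only [LexLT] at this <;> omega
  have hdown : ∀ q ∈ downSet r s p, q ∉ l₂ := fun q hq h => by
    have := h₂ q h
    rcases (mem_downSet.1 hq).1 with rfl | rfl <;> simp only [LexLT] at this <;> omega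
  rw [List.foldl_append, List.foldl_cons, foldl_toggle_of_notMem _ hp₂, toggle_self,
    foldl_toggle_of_notMem x hp₁, usum_congr fun q hq => foldl_toggle_of_notMem x (hup q hq)]
  congr 2
  refine dsum_congr fun q hq => ?_
  rw [foldl_toggle_of_notMem _ (hdown q hq), toggle_of_ne _ (ne_of_mem_downSet hq)]

lemma rectList_eq (a b : ℕ) : rectList a b =
    (List.range a).reverse.flatMap fun i : ℕ =>
      (List.range b).reverse.map fun j : ℕ => ((i : ℤ) + 1, (j : ℤ) + 1) := by
  simp only [rectList, List.bind_eq_flatMap, List.pure_def, List.flatMap_assoc,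
    List.flatMap_cons, List.flatMap_nil, List.append_nil, List.map_eq_flatMap]

lemma mem_rectList {r s : ℕ} {p : ℤ × ℤ} : p ∈ rectList r s ↔ inR r s p := by
  obtain ⟨a, b⟩ := p
  simp only [rectList_eq, List.mem_flatMap, List.mem_reverse, List.mem_range, List.mem_map,
    Prod.mk.injEq, inR]
  constructor
  · rintro ⟨i, hi, j, hj, rfl, rfl⟩
    omega
  · rintro ⟨h₁, h₂, h₃, h₄⟩
    exact ⟨(a - 1).toNat, by omega, (b - 1).toNat, by omega, by omega, by omega⟩

lemma pairwise_reverse_rectList (r s : ℕ) : (rectList r s).reverse.Pairwise LexLT := by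
  rw [List.pairwise_reverse, rectList_eq, List.pairwise_flatMap]
  refine ⟨fun i _ => ?_, ?_⟩
  · rw [List.pairwise_map, List.pairwise_reverse]
    refine List.pairwise_lt_range.imp fun {a b} h => Or.inr ⟨rfl, ?_⟩
    simpa using h
  · rw [List.pairwise_reverse]
    refine List.pairwise_lt_range.imp fun {a b} h p hp q hq => Or.inl ?_
    simp only [List.mem_map] at hp hq
    obtain ⟨j, -, rfl⟩ := hp
    obtain ⟨k, -, rfl⟩ := hq
    simpa using h

/-! ### Rowmotion -/

lemma rho_pos {r s : ℕ} {x : ℤ × ℤ → ℝ} (hx : ∀ q, inR r s q → 0 < x q) :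
    ∀ q, inR r s q → 0 < rho r s x q :=
  foldl_toggle_pos _ hx

lemma rhoInv_rho {r s : ℕ} {x : ℤ × ℤ → ℝ} (hx : ∀ q, inR r s q → 0 < x q) :
    rhoInv r s (rho r s x) = x :=
  foldl_toggle_reverse (fun _ => mem_rectList.1) hx

lemma rho_rhoInv {r s : ℕ} {x : ℤ × ℤ → ℝ} (hx : ∀ q, inR r s q → 0 < x q) :
    rho r s (rhoInv r s x) = x := by
  have h := foldl_toggle_reverse (l := (rectList r s).reverse)
    (fun p hp => mem_rectList.1 (List.mem_reverse.1 hp)) hx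
  rwa [List.reverse_reverse] at h

lemma rhoInv_apply {r s : ℕ} (x : ℤ × ℤ → ℝ) {p : ℤ × ℤ} (hp : inR r s p) :
    rhoInv r s x p = usum r s x p * dsum r s (rhoInv r s x) p / x p :=
  foldl_toggle_apply (pairwise_reverse_rectList r s) x
    (List.mem_reverse.2 (mem_rectList.2 hp))

lemma iterate_rhoInv_pos {r s : ℕ} {x : ℤ × ℤ → ℝ} (hx : ∀ q, inR r s q → 0 < x q) (k : ℕ) :
    ∀ q, inR r s q → 0 < (rhoInv r s)^[k] x q := by
  induction k with
  | zero => exact hx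
  | succ k ih =>
    rw [Function.iterate_succ_apply']
    exact foldl_toggle_pos _ ih

lemma eq_of_iterate_rhoInv_eq {r s : ℕ} {x y : ℤ × ℤ → ℝ} (hx : ∀ q, inR r s q → 0 < x q)
    (hy : ∀ q, inR r s q → 0 < y q) (k : ℕ)
    (h : ∀ q, inR r s q → (rhoInv r s)^[k] x q = (rhoInv r s)^[k] y q) :
    ∀ q, inR r s q → x q = y q := by
  induction k with
  | zero => exact h
  | succ k ih =>
    rw [Function.iterate_succ_apply', Function.iterate_succ_apply'] at h
    apply ih
    intro q hq
    have := foldl_toggle_congr (rectList r s) h q hq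
    change rho r s _ q = rho r s _ q at this
    rwa [rho_rhoInv (iterate_rhoInv_pos hx k), rho_rhoInv (iterate_rhoInv_pos hy k)] at this

lemma dsum_eq_add {r s : ℕ} (x : ℤ × ℤ → ℝ) {p : ℤ × ℤ} (hp : inR r s p) (hp' : p ≠ (1, 1)) :
    dsum r s x p = (if 2 ≤ p.1 then x (p.1 - 1, p.2) else 0) +
      (if 2 ≤ p.2 then x (p.1, p.2 - 1) else 0) := by
  obtain ⟨a, b⟩ := p
  have h₁ : inR r s (a - 1, b) ↔ 2 ≤ a := by simp only [inR] at hp ⊢; omega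
  have h₂ : inR r s (a, b - 1) ↔ 2 ≤ b := by simp only [inR] at hp ⊢; omega
  have hne : (downSet r s (a, b)).Nonempty := by
    by_cases ha : 2 ≤ a
    · exact ⟨_, mem_downSet.2 ⟨Or.inl rfl, h₁.2 ha⟩⟩
    · refine ⟨_, mem_downSet.2 ⟨Or.inr rfl, h₂.2 ?_⟩⟩
      simp only [inR, ne_eq, Prod.mk.injEq] at hp hp'
      omega
  rw [dsum, if_pos hne, downSet, Finset.sum_filter, Finset.sum_pair (by simp [Prod.ext_iff])]
  simp only [h₁, h₂]

/-- A rowmotion orbit is determined on the columns left of the last one by its values on the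
last column. -/
lemma iterate_rhoInv_eq_of_last_column {r s : ℕ} {x y : ℤ × ℤ → ℝ}
    (hy : ∀ q, inR r s q → 0 < y q)
    (h : ∀ i : ℤ, 1 ≤ i → i ≤ r → ∀ k : ℕ, 1 ≤ k → k ≤ s →
      (rhoInv r s)^[k] x (i, s) = (rhoInv r s)^[k] y (i, s)) (n : ℕ) :
    ∀ i j : ℤ, inR r s (i, j) → (s : ℤ) ≤ j + n → ∀ k : ℕ, (s : ℤ) + 1 ≤ k + j → k ≤ s →
      (rhoInv r s)^[k] x (i, j) = (rhoInv r s)^[k] y (i, j) := by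
  induction n with
  | zero =>
    intro i j hij hj k hk hks
    simp only [inR] at hij
    obtain rfl : j = s := by omega
    exact h i hij.1 hij.2.1 k (by omega) hks
  | succ n ih =>
    intro i j hij hj k hk hks
    obtain hj' | hj' := le_or_gt (s : ℤ) (j + n)
    · exact ih i j hij hj' k hk hks
    have hij' := hij
    simp only [inR] at hij'
    obtain ⟨k, rfl⟩ : ∃ m, k = m + 1 := ⟨k - 1, by omega⟩
    have hp : inR r s (i, j + 1) := by simp only [inR]; omega
    have hp' : ((i, j + 1) : ℤ × ℤ) ≠ (1, 1) := by simp only [ne_eq, Prod.mk.injEq]; omega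
    have hu : usum r s ((rhoInv r s)^[k] x) (i, j + 1) =
        usum r s ((rhoInv r s)^[k] y) (i, j + 1) := by
      refine usum_congr fun q hq => ?_
      obtain ⟨hq, hqR⟩ := mem_upSet.1 hq
      rcases hq with rfl | rfl
      · exact ih _ _ hqR (by omega) k (by push_cast at hk ⊢; omega) (by omega)
      · exact ih _ _ hqR (by omega) k (by push_cast at hk ⊢; omega) (by omega)
    have e₀ := ih _ _ hp (by omega) k (by push_cast at hk ⊢; omega) (by omega)
    have e₁ := ih _ _ hp (by omega) (k + 1) (by push_cast at hk ⊢; omega) hks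
    have ex := rhoInv_apply ((rhoInv r s)^[k] x) hp
    have ey := rhoInv_apply ((rhoInv r s)^[k] y) hp
    rw [← Function.iterate_succ_apply' (rhoInv r s)] at ex ey
    have hupos := usum_pos (iterate_rhoInv_pos hy k) (i, j + 1)
    have hypos := iterate_rhoInv_pos hy k _ hp
    rw [e₁, ey, hu, e₀, div_left_inj' hypos.ne', mul_right_inj' hupos.ne',
      dsum_eq_add _ hp hp', dsum_eq_add _ hp hp'] at ex
    have hj2 : (2 : ℤ) ≤ j + 1 := by omega
    simp only [hj2, if_true, add_sub_cancel_right] at ex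
    have hc : (if 2 ≤ i then (rhoInv r s)^[k + 1] x (i - 1, j + 1) else 0) =
        (if 2 ≤ i then (rhoInv r s)^[k + 1] y (i - 1, j + 1) else 0) := by
      split_ifs with hi
      · exact ih _ _ (by simp only [inR]; omega) (by omega) (k + 1)
          (by push_cast at hk ⊢; omega) hks
      · rfl
    rw [hc] at ex
    exact (add_left_cancel ex).symm

/-! ### The inverse transfer map -/

/-- The set of saturated chains from `(1, 1)` to `p`. -/
def chainSet (p : ℤ × ℤ) : Set (List (ℤ × ℤ)) :=
  {l | l.IsChain CoverStep ∧ l.head? = some (1, 1) ∧ l.getLast? = some p}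

lemma phiInv_eq_finsum_mem (x : ℤ × ℤ → ℝ) (p : ℤ × ℤ) :
    phiInv x p = ∑ᶠ l ∈ chainSet p, (l.map x).prod :=
  finsum_set_coe_eq_finsum_mem (f := fun l : List (ℤ × ℤ) => (l.map x).prod) (chainSet p)

lemma append_singleton_mem_chainSet {l : List (ℤ × ℤ)} {p q : ℤ × ℤ} :
    l ++ [q] ∈ chainSet p ↔ q = p ∧
      ((l = [] ∧ p = (1, 1)) ∨ ∃ t, CoverStep t p ∧ l ∈ chainSet t) := by
  rcases List.eq_nil_or_concat l with rfl | ⟨l, t, rfl⟩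
  · simp only [chainSet, Set.mem_ofPred_eq]
    simp
    grind
  · simp only [chainSet, Set.mem_ofPred_eq, List.isChain_append]
    simp
    grind

lemma le_of_mem_chainSet {l : List (ℤ × ℤ)} {p : ℤ × ℤ} (h : l ∈ chainSet p) :
    1 ≤ p.1 ∧ 1 ≤ p.2 := by
  induction l using List.reverseRecOn generalizing p with
  | nil => simp [chainSet] at h
  | append_singleton l q ih =>
    obtain ⟨rfl, ⟨-, rfl⟩ | ⟨t, ht, hl⟩⟩ := append_singleton_mem_chainSet.1 h
    · simp
    · have := ih hl
      simp only [CoverStep] at ht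
      omega

lemma chainSet_one : chainSet (1, 1) = {[(1, 1)]} := by
  ext l
  rw [Set.mem_singleton_iff]
  constructor
  · intro h
    induction l using List.reverseRecOn with
    | nil => simp [chainSet] at h
    | append_singleton l q _ =>
      obtain ⟨rfl, ⟨rfl, -⟩ | ⟨t, ht, hl⟩⟩ := append_singleton_mem_chainSet.1 h
      · rfl
      · have := le_of_mem_chainSet hl
        simp only [CoverStep] at ht
        omega
  · rintro rfl
    simp [chainSet]

lemma chainSet_of_ne {p : ℤ × ℤ} (hp : p ≠ (1, 1)) :
    chainSet p = (· ++ [p]) '' (chainSet (p.1 - 1, p.2) ∪ chainSet (p.1, p.2 - 1)) := by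
  ext l
  induction l using List.reverseRecOn with
  | nil => simp [chainSet]
  | append_singleton l q _ =>
    rw [append_singleton_mem_chainSet]
    constructor
    · rintro ⟨rfl, ⟨-, h⟩ | ⟨t, ht, hl⟩⟩
      · exact absurd h hp
      · refine ⟨l, ?_, rfl⟩
        rcases ht with ht | ht
        · have : t = (q.1 - 1, q.2) := by ext <;> simp only <;> omega
          exact Or.inl (this ▸ hl)
        · have : t = (q.1, q.2 - 1) := by ext <;> simp only <;> omega
          exact Or.inr (this ▸ hl)
    · rintro ⟨m, hm, he⟩
      obtain ⟨rfl, he⟩ := List.append_inj' he rfl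
      obtain rfl : p = q := by simpa using he
      refine ⟨rfl, Or.inr ?_⟩
      rcases hm with hm | hm
      · exact ⟨(p.1 - 1, p.2), Or.inl ⟨by simp, rfl⟩, hm⟩
      · exact ⟨(p.1, p.2 - 1), Or.inr ⟨rfl, by simp⟩, hm⟩

lemma chainSet_finite (n : ℕ) : ∀ p : ℤ × ℤ, p.1 + p.2 ≤ n → (chainSet p).Finite := by
  induction n with
  | zero =>
    intro p hp
    convert Set.finite_empty
    refine Set.eq_empty_of_forall_notMem fun l hl => ?_
    have := le_of_mem_chainSet hl
    push_cast at hp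
    omega
  | succ n ih =>
    intro p hp
    push_cast at hp
    by_cases h : p = (1, 1)
    · rw [h, chainSet_one]
      exact Set.finite_singleton _
    · rw [chainSet_of_ne h]
      exact ((ih _ (by simp only; omega)).union (ih _ (by simp only; omega))).image _

lemma finite_chainSet (p : ℤ × ℤ) : (chainSet p).Finite :=
  chainSet_finite (p.1 + p.2).toNat p (Int.self_le_toNat _)

lemma phiInv_one (x : ℤ × ℤ → ℝ) : phiInv x (1, 1) = x (1, 1) := by
  rw [phiInv_eq_finsum_mem, chainSet_one, finsum_mem_singleton]
  simp

lemma phiInv_of_lt (x : ℤ × ℤ → ℝ) {p : ℤ × ℤ} (hp : ¬(1 ≤ p.1 ∧ 1 ≤ p.2)) :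
    phiInv x p = 0 := by
  have : chainSet p = ∅ :=
    Set.eq_empty_of_forall_notMem fun l hl => hp (le_of_mem_chainSet hl)
  rw [phiInv_eq_finsum_mem, this, finsum_mem_empty]

lemma phiInv_of_ne (x : ℤ × ℤ → ℝ) {p : ℤ × ℤ} (hp : p ≠ (1, 1)) :
    phiInv x p = x p * (phiInv x (p.1 - 1, p.2) + phiInv x (p.1, p.2 - 1)) := by
  have hdisj : Disjoint (chainSet (p.1 - 1, p.2)) (chainSet (p.1, p.2 - 1)) := by
    refine Set.disjoint_left.2 fun l h₁ h₂ => ?_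
    have h := h₁.2.2.symm.trans h₂.2.2
    simp at h
  rw [phiInv_eq_finsum_mem, chainSet_of_ne hp,
    finsum_mem_image fun _ _ _ _ h => List.append_cancel_right h,
    finsum_mem_union hdisj (finite_chainSet _) (finite_chainSet _),
    phiInv_eq_finsum_mem x (p.1 - 1, p.2), phiInv_eq_finsum_mem x (p.1, p.2 - 1), mul_add,
    mul_finsum_mem, mul_finsum_mem]
  simp [mul_comm]

lemma phiInv_eq_mul_dsum {r s : ℕ} (x : ℤ × ℤ → ℝ) {p : ℤ × ℤ} (hp : inR r s p) :
    phiInv x p = x p * dsum r s (phiInv x) p := by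
  by_cases h : p = (1, 1)
  · subst h
    have : ¬(downSet r s (1, 1)).Nonempty := by
      rintro ⟨q, hq⟩
      obtain ⟨hq, hqR⟩ := mem_downSet.1 hq
      rcases hq with rfl | rfl <;> simp [inR] at hqR
    rw [phiInv_one, dsum, if_neg this, mul_one]
  · rw [phiInv_of_ne x h, dsum_eq_add _ hp h]
    have h₁ : (if 2 ≤ p.1 then phiInv x (p.1 - 1, p.2) else 0) = phiInv x (p.1 - 1, p.2) := by
      split_ifs with hc
      · rfl
      · exact (phiInv_of_lt x (by simp only; omega)).symm
    have h₂ : (if 2 ≤ p.2 then phiInv x (p.1, p.2 - 1) else 0) = phiInv x (p.1, p.2 - 1) := by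
      split_ifs with hc
      · rfl
      · exact (phiInv_of_lt x (by simp only; omega)).symm
    rw [h₁, h₂]

lemma phiInv_pos {r s : ℕ} {x : ℤ × ℤ → ℝ} (hx : ∀ q, inR r s q → 0 < x q) :
    ∀ p, inR r s p → 0 < phiInv x p := by
  suffices H : ∀ (n : ℕ) (p : ℤ × ℤ), p.1 + p.2 ≤ n → inR r s p → 0 < phiInv x p from
    fun p => H (p.1 + p.2).toNat p (Int.self_le_toNat _)
  intro n
  induction n with
  | zero =>
    intro p hp hpR
    simp only [inR] at hpR
    push_cast at hp
    omega
  | succ n ih =>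
    intro p hp hpR
    push_cast at hp
    rw [phiInv_eq_mul_dsum x hpR]
    refine mul_pos (hx p hpR) ?_
    unfold dsum
    split_ifs with h
    · refine Finset.sum_pos (fun q hq => ?_) h
      obtain ⟨hq, hqR⟩ := mem_downSet.1 hq
      refine ih q ?_ hqR
      rcases hq with rfl | rfl <;> simp only <;> omega
    · exact one_pos

lemma phi_phiInv {r s : ℕ} {x : ℤ × ℤ → ℝ} (hx : ∀ q, inR r s q → 0 < x q) {p : ℤ × ℤ}
    (hp : inR r s p) : phi r s (phiInv x) p = x p := by
  rw [phi, phiInv_eq_mul_dsum x hp, mul_div_cancel_right₀ _ (dsum_pos (phiInv_pos hx) p).ne']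

/-- **Corollary 5.7.** If `z` cyclically shifts all generalized Stanley–Thomas words of
`x` (i.e. `ST_i(z)_k = ST_i(x)_{k-1 mod r+s}` for all `1 ≤ i ≤ r` and likewise for all
`ST̄_j`), then `z = φ(ρ(φ⁻¹(x)))`; so `φ ∘ ρ ∘ φ⁻¹` is the unique function on
`ℝ_{>0}^R` cyclically shifting all generalized Stanley–Thomas words. -/
theorem rowmotion_unique_ST_shift (r s : ℕ) (hr : 1 ≤ r) (hs : 1 ≤ s)
    (x z : ℤ × ℤ → ℝ)
    (hx : ∀ p, inR r s p → 0 < x p) (hz : ∀ p, inR r s p → 0 < z p)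
    (hST : ∀ i : ℤ, 1 ≤ i → i ≤ (r : ℤ) → ∀ k : ℕ, k < r + s →
      STentry r s z i k = STentry r s x i ((k + (r + s) - 1) % (r + s)))
    (hSTbar : ∀ j : ℤ, 1 ≤ j → j ≤ (s : ℤ) → ∀ k : ℕ, k < r + s →
      STbarEntry r s z j k = STbarEntry r s x j ((k + (r + s) - 1) % (r + s))) :
    ∀ p, inR r s p → z p = phi r s (rho r s (phiInv x)) p := by
  have hy := phiInv_pos hx
  have hw := phiInv_pos hz
  have hρ := rho_pos hy
  have hcol : ∀ i : ℤ, 1 ≤ i → i ≤ r → ∀ k : ℕ, 1 ≤ k → k ≤ s →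
      (rhoInv r s)^[k] (phiInv z) (i, s) =
        (rhoInv r s)^[k] (rho r s (phiInv x)) (i, s) := by
    intro i hi hir k hk hks
    obtain ⟨k, rfl⟩ : ∃ m, k = m + 1 := ⟨k - 1, by omega⟩
    have h := hST i hi hir (k + 1) (by omega)
    have hmod : (k + 1 + (r + s) - 1) % (r + s) = k := by
      rw [show k + 1 + (r + s) - 1 = k + (r + s) by omega, Nat.add_mod_right,
        Nat.mod_eq_of_lt (by omega)]
    rw [hmod] at h
    rw [Function.iterate_succ_apply _ k (rho r s (phiInv x)), rhoInv_rho hy]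
    exact h
  have heq : ∀ p, inR r s p → phiInv z p = rho r s (phiInv x) p := by
    refine eq_of_iterate_rhoInv_eq hw hρ s fun p hp => ?_
    have hp' := hp
    simp only [inR] at hp'
    exact iterate_rhoInv_eq_of_last_column hρ hcol s p.1 p.2 hp (by omega) s (by omega) le_rfl
  intro p hp
  rw [← phi_phiInv hz hp, phi, phi, heq p hp,
    dsum_congr fun q hq => heq q (mem_downSet.1 hq).2]

end Paper
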